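/- Let k ≥ 2, let P₁, …, P_k ∈ ℝ³ be distinct points, let m ≥ 0, and define φ : ℝ³ \ {P₁, …, P_k} → ℝ by φ(x) = m + Σ_{i=1}^{k} 1/(2‖x − Pᵢ‖). Assume every critical point of φ is nondegenerate. Then φ has at least k − 1 critical points of Morse index 2. -/

import Mathlib

noncomputable section

/-- The Hessian of `phi` at `x`, as a bilinear form. -/
def hessianForm (phi : EuclideanSpace ℝ (Fin 3) → ℝ)
    (x u v : EuclideanSpace ℝ (Fin 3)) : ℝ :=
  iteratedFDeriv ℝ 2 phi x ![u, v]

/-- A critical point is nondegenerate if its Hessian form is nondegenerate. -/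
def IsNondegenerateCrit (phi : EuclideanSpace ℝ (Fin 3) → ℝ)
    (x : EuclideanSpace ℝ (Fin 3)) : Prop :=
  ∀ u : EuclideanSpace ℝ (Fin 3), (∀ v, hessianForm phi x u v = 0) → u = 0

/-- The Morse index of `phi` at `x` is `n`: the Hessian is negative definite
on an `n`-dimensional subspace and positive definite on a complementary
`(3-n)`-dimensional subspace. -/
def HasMorseIndex (phi : EuclideanSpace ℝ (Fin 3) → ℝ)
    (x : EuclideanSpace ℝ (Fin 3)) (n : ℕ) : Prop :=
  (∃ W : Submodule ℝ (EuclideanSpace ℝ (Fin 3)), Module.finrank ℝ W = n ∧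
    ∀ u ∈ W, u ≠ 0 → hessianForm phi x u u < 0) ∧
  (∃ W : Submodule ℝ (EuclideanSpace ℝ (Fin 3)), Module.finrank ℝ W = 3 - n ∧
    ∀ u ∈ W, u ≠ 0 → 0 < hessianForm phi x u u)

open Set Filter Topology
open scoped ENNReal

/-- Every component of a superlevel set contains a pole. -/
theorem topo_pole {X : Type*} [TopologicalSpace X] [LocallyConnectedSpace X] [T2Space X]
    {k : ℕ} (P : Fin k → X) (Φ : X → ℝ≥0∞) (hΦ : Continuous Φ)
    (hmax : ∀ p, p ∉ range P → p ∈ closure {x | Φ p < Φ x})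
    (c : ℝ≥0∞) (hcomp : IsCompact {x | c ≤ Φ x}) (x : X) (hx : c < Φ x) :
    ∃ i, x ∈ connectedComponentIn {y | c < Φ y} (P i) := by
  set F := {y | c < Φ y} with hF
  have hFo : IsOpen F := isOpen_lt continuous_const hΦ
  set C := connectedComponentIn F x with hC
  have hCo : IsOpen C := hFo.connectedComponentIn
  have hxC : x ∈ C := mem_connectedComponentIn hx
  have hCF : C ⊆ F := connectedComponentIn_subset F x
  have hcl : closure C ⊆ {x | c ≤ Φ x} :=
    closure_minimal (fun y hy => le_of_lt (b := Φ y) (hCF hy)) (isClosed_le continuous_const hΦ)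
  have hK : IsCompact (closure C) := hcomp.of_isClosed_subset isClosed_closure hcl
  obtain ⟨y, hy, hmaxy⟩ := hK.exists_isMaxOn ⟨x, subset_closure hxC⟩ hΦ.continuousOn
  have hyF : y ∈ F := lt_of_lt_of_le hx (hmaxy (subset_closure hxC))
  have hyC : y ∈ C := by
    obtain ⟨z, hz1, hz2⟩ := mem_closure_iff.1 hy _ (hFo.connectedComponentIn (x := y))
      (mem_connectedComponentIn hyF)
    have h1 := connectedComponentIn_eq hz1
    have h2 := connectedComponentIn_eq hz2
    rw [hC, h2, ← h1]
    exact mem_connectedComponentIn hyF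
  by_cases hyP : y ∈ range P
  · obtain ⟨i, rfl⟩ := hyP
    refine ⟨i, ?_⟩
    rw [← connectedComponentIn_eq hyC]
    exact hxC
  · obtain ⟨z, hz1, hz2⟩ := mem_closure_iff.1 (hmax y hyP) C hCo hyC
    exact (not_le.2 (show Φ y < Φ z from hz2) (hmaxy (subset_closure hz1))).elim

/-- The merging point attached to a cut of the set of poles. -/
theorem topo_cut {X : Type*} [TopologicalSpace X] [LocallyPathConnectedSpace X] [T2Space X]
    {k : ℕ} (P : Fin k → X) (hP : Function.Injective P) (Φ : X → ℝ≥0∞) (hΦ : Continuous Φ)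
    (htop : ∀ i, Φ (P i) = ⊤)
    (hmax : ∀ p, p ∉ range P → p ∈ closure {x | Φ p < Φ x})
    (m : ℝ≥0∞) (hcomp : ∀ c, m < c → IsCompact {x | c ≤ Φ x})
    (hconn : ∃ c, m < c ∧ ∃ S, IsPreconnected S ∧ S ⊆ {x | c < Φ x} ∧ range P ⊆ S)
    (A : Set (Fin k)) (a₀ b₀ : Fin k) (ha₀ : a₀ ∈ A) (hb₀ : b₀ ∉ A) :
    ∃ p, p ∉ range P ∧
      (∀ a ∈ A, ∀ b, b ∉ A → Disjoint (connectedComponentIn {y | Φ p < Φ y} (P a))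
        (connectedComponentIn {y | Φ p < Φ y} (P b))) ∧
      p ∈ closure (⋃ a ∈ A, connectedComponentIn {y | Φ p < Φ y} (P a)) ∧
      p ∈ closure (⋃ b ∈ Aᶜ, connectedComponentIn {y | Φ p < Φ y} (P b)) := by
  set T : Set ℝ≥0∞ := {c | ∃ a ∈ A, ∃ b ∈ Aᶜ, ∃ S, IsPreconnected S ∧ S ⊆ {x | c < Φ x} ∧
    P a ∈ S ∧ P b ∈ S} with hT
  set s := sSup T with hs
  have hms : m < s := by
    obtain ⟨c, hc, S, h1, h2, h3⟩ := hconn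
    refine lt_of_lt_of_le hc (le_sSup ?_)
    exact ⟨a₀, ha₀, b₀, hb₀, S, h1, h2, h3 ⟨_, rfl⟩, h3 ⟨_, rfl⟩⟩
  set F := {y | s < Φ y} with hF
  have hFo : IsOpen F := isOpen_lt continuous_const hΦ
  have hdisj : ∀ a ∈ A, ∀ b ∈ Aᶜ, Disjoint (connectedComponentIn F (P a))
        (connectedComponentIn F (P b)) := by
    intro a ha b hb
    rw [Set.disjoint_left]
    intro z hza hzb
    have e1 := connectedComponentIn_eq hza
    have e2 := connectedComponentIn_eq hzb
    have haF : P a ∈ F := by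
      by_contra h
      rw [connectedComponentIn_eq_empty h] at hza
      exact hza
    have hbF : P b ∈ F := by
      by_contra h
      rw [connectedComponentIn_eq_empty h] at hzb
      exact hzb
    have haC : P a ∈ connectedComponentIn F (P a) := mem_connectedComponentIn haF
    have hbC : P b ∈ connectedComponentIn F (P a) := by
      rw [e1, ← e2]; exact mem_connectedComponentIn hbF
    have hCo : IsOpen (connectedComponentIn F (P a)) := hFo.connectedComponentIn
    have hpc : IsPathConnected (connectedComponentIn F (P a)) :=
      hCo.isConnected_iff_isPathConnected.1
        (isConnected_connectedComponentIn_iff.2 haF)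
    obtain ⟨γ, hγ⟩ := hpc.joinedIn _ haC _ hbC
    have hrc : IsCompact (range γ) := isCompact_range γ.continuous
    obtain ⟨y, ⟨t, rfl⟩, hmin⟩ := hrc.exists_isMinOn (range_nonempty _) hΦ.continuousOn
    obtain ⟨c, hc1, hc2⟩ := exists_between
      (show s < Φ (γ t) from connectedComponentIn_subset F _ (hγ t))
    have : c ∈ T := by
      refine ⟨a, ha, b, hb, range γ, isPreconnected_range γ.continuous, ?_, ⟨0, γ.source⟩,
        ⟨1, γ.target⟩⟩
      intro y hy
      exact lt_of_lt_of_le hc2 (hmin hy)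
    exact absurd (le_sSup this) (not_le.2 hc1)
  set UA := ⋃ a ∈ A, connectedComponentIn F (P a) with hUA
  set UB := ⋃ b ∈ Aᶜ, connectedComponentIn F (P b) with hUB
  have hUAo : IsOpen UA := isOpen_biUnion fun a _ => hFo.connectedComponentIn
  have hUBo : IsOpen UB := isOpen_biUnion fun a _ => hFo.connectedComponentIn
  have hUAF : UA ⊆ F := iUnion₂_subset fun a _ => connectedComponentIn_subset F _
  have hUBF : UB ⊆ F := iUnion₂_subset fun a _ => connectedComponentIn_subset F _
  have hUd : Disjoint UA UB := by
    rw [hUA, hUB, Set.disjoint_iUnion₂_left]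
    intro a ha
    rw [Set.disjoint_iUnion₂_right]
    intro b hb
    exact hdisj a ha b hb
  have hcover : ∀ x ∈ F, x ∈ UA ∨ x ∈ UB := by
    intro x hx
    obtain ⟨i, hi⟩ := topo_pole P Φ hΦ hmax s (hcomp s hms) x hx
    by_cases hiA : i ∈ A
    · left; exact mem_biUnion hiA hi
    · right; exact mem_biUnion (show i ∈ Aᶜ from hiA) hi
  have hclF : ∀ U, U ⊆ F → closure U ⊆ {x | s ≤ Φ x} := fun U hU =>
    closure_minimal (fun y hy => le_of_lt (b := Φ y) (hU hy)) (isClosed_le continuous_const hΦ)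
  set KA := closure UA ∪ P '' A with hKA
  set KB := closure UB ∪ P '' Aᶜ with hKB
  have hKAc : IsCompact KA :=
    ((hcomp s hms).of_isClosed_subset isClosed_closure (hclF _ hUAF)).union
      (A.toFinite.image P).isCompact
  have hKBc : IsCompact KB :=
    ((hcomp s hms).of_isClosed_subset isClosed_closure (hclF _ hUBF)).union
      (Aᶜ.toFinite.image P).isCompact
  have hKcov : {x | s ≤ Φ x} ⊆ KA ∪ KB := by
    intro x hx
    by_cases hxP : x ∈ range P
    · obtain ⟨i, rfl⟩ := hxP
      by_cases hiA : i ∈ A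
      · left; right; exact ⟨i, hiA, rfl⟩
      · right; right; exact ⟨i, hiA, rfl⟩
    · rcases lt_or_eq_of_le (show s ≤ Φ x from hx) with h | h
      · rcases hcover x h with h | h
        · left; left; exact subset_closure h
        · right; left; exact subset_closure h
      · have h1 := hmax x hxP
        rw [← h] at h1
        have h2 : closure F ⊆ closure UA ∪ closure UB := by
          rw [← closure_union]; exact closure_mono hcover
        rcases h2 h1 with h | h
        · left; left; exact h
        · right; left; exact h
  have hnd : ¬ Disjoint KA KB := by
    intro hd
    obtain ⟨VA, VB, hVA, hVB, hKVA, hKVB, hVd⟩ :=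
      SeparatedNhds.of_isCompact_isCompact hKAc hKBc hd
    obtain ⟨c0, hc0, hc0s⟩ := exists_between hms
    have hL : IsCompact ({x | c0 ≤ Φ x} \ (VA ∪ VB)) := (hcomp c0 hc0).diff (hVA.union hVB)
    have hex : ∃ c < s, {x | c < Φ x} ⊆ VA ∪ VB := by
      rcases ({x | c0 ≤ Φ x} \ (VA ∪ VB)).eq_empty_or_nonempty with he | hne
      · refine ⟨c0, hc0s, fun x hx => ?_⟩
        by_contra hxV
        have : x ∈ ({x | c0 ≤ Φ x} \ (VA ∪ VB)) := ⟨le_of_lt (b := Φ x) hx, hxV⟩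
        rw [he] at this; exact this
      · obtain ⟨y, hy, hym⟩ := hL.exists_isMaxOn hne hΦ.continuousOn
        have hys : Φ y < s := by
          by_contra h
          apply hy.2
          rcases hKcov (not_lt.1 h) with h | h
          · exact Or.inl (hKVA h)
          · exact Or.inr (hKVB h)
        refine ⟨Φ y, hys, fun x hx => ?_⟩
        by_contra hxV
        have : x ∈ ({x | c0 ≤ Φ x} \ (VA ∪ VB)) := ⟨le_trans (c := Φ x) hy.1 (le_of_lt (b := Φ x) hx), hxV⟩
        exact not_le.2 (show Φ y < Φ x from hx) (hym this)
    obtain ⟨c, hcs, hcV⟩ := hex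
    obtain ⟨c', ⟨a, ha, b, hb, S, hS, hSc, haS, hbS⟩, hcc'⟩ := lt_sSup_iff.1 hcs
    have hSV : S ⊆ VA ∪ VB := fun x hx => hcV (lt_trans hcc' (hSc hx))
    have haV : P a ∈ VA := hKVA (Or.inr ⟨a, ha, rfl⟩)
    have hbV : P b ∈ VB := hKVB (Or.inr ⟨b, hb, rfl⟩)
    obtain ⟨z, _, hz1, hz2⟩ := hS VA VB hVA hVB hSV ⟨_, haS, haV⟩ ⟨_, hbS, hbV⟩
    exact Set.disjoint_left.1 hVd hz1 hz2
  have hUAcl : ∀ x ∈ UA, x ∉ closure UB := fun x hx hx' => by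
    obtain ⟨z, h1, h2⟩ := mem_closure_iff.1 hx' UA hUAo hx
    exact Set.disjoint_left.1 hUd h1 h2
  have hUBcl : ∀ x ∈ UB, x ∉ closure UA := fun x hx hx' => by
    obtain ⟨z, h1, h2⟩ := mem_closure_iff.1 hx' UB hUBo hx
    exact Set.disjoint_left.1 hUd h2 h1
  have hFne : ∀ U ⊆ F, ∀ x ∈ closure U, ∀ i, P i ∈ F := by
    intro U hU x hx i
    have : U.Nonempty := closure_nonempty_iff.1 ⟨x, hx⟩
    obtain ⟨z, hz⟩ := this
    have := hU hz
    rw [hF, mem_ofPred_eq, htop]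
    exact lt_of_lt_of_le (hU hz) le_top
  have hAU : ∀ U ⊆ F, ∀ x ∈ closure U, ∀ a ∈ A, P a ∈ UA := fun U hU x hx a ha =>
    mem_biUnion ha (mem_connectedComponentIn (hFne U hU x hx a))
  have hBU : ∀ U ⊆ F, ∀ x ∈ closure U, ∀ a ∈ Aᶜ, P a ∈ UB := fun U hU x hx a ha =>
    mem_biUnion ha (mem_connectedComponentIn (hFne U hU x hx a))
  obtain ⟨p, hpA, hpB⟩ := Set.not_disjoint_iff.1 hnd
  have hpcl : p ∈ closure UA ∧ p ∈ closure UB := by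
    rcases hpA with hpA | ⟨a, ha, rfl⟩
    · refine ⟨hpA, ?_⟩
      rcases hpB with hpB | ⟨b, hb, rfl⟩
      · exact hpB
      · exact absurd hpA (hUBcl _ (hBU UA hUAF _ hpA b hb))
    · rcases hpB with hpB | ⟨b, hb, h⟩
      · exact absurd hpB (hUAcl _ (hAU UB hUBF _ hpB a ha))
      · exact absurd ha (hP h ▸ hb)
  have hpP : p ∉ range P := by
    rintro ⟨i, rfl⟩
    by_cases hiA : i ∈ A
    · exact hUAcl _ (hAU UA hUAF _ hpcl.1 i hiA) hpcl.2
    · exact hUBcl _ (hBU UA hUAF _ hpcl.1 i hiA) hpcl.1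
  have hps : Φ p = s := by
    refine le_antisymm ?_ (hclF UA hUAF hpcl.1)
    by_contra h
    rcases hcover p (not_le.1 h) with h | h
    · exact hUAcl _ h hpcl.2
    · exact hUBcl _ h hpcl.1
  refine ⟨p, hpP, ?_⟩
  rw [hps]
  exact ⟨hdisj, hpcl⟩

theorem topo_main {X : Type*} [TopologicalSpace X] [LocallyPathConnectedSpace X] [T2Space X]
    {k : ℕ} (hk : 0 < k) (P : Fin k → X) (hP : Function.Injective P)
    (Φ : X → ℝ≥0∞) (hΦ : Continuous Φ)
    (htop : ∀ i, Φ (P i) = ⊤)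
    (hmax : ∀ p, p ∉ range P → p ∈ closure {x | Φ p < Φ x})
    (m : ℝ≥0∞) (hm : ∀ x, m < Φ x) (hcomp : ∀ c, m < c → IsCompact {x | c ≤ Φ x})
    (hconn : ∃ c, m < c ∧ ∃ S, IsPreconnected S ∧ S ⊆ {x | c < Φ x} ∧ range P ⊆ S)
    (Z : Set X) (hZ : Z.Finite)
    (hloc : ∀ p, p ∉ range P → ∃ S₁ S₂ : Set X, S₁.Nonempty ∧ S₂.Nonempty ∧
      IsPreconnected S₁ ∧ IsPreconnected S₂ ∧ S₁ ⊆ {x | Φ p < Φ x} ∧ S₂ ⊆ {x | Φ p < Φ x} ∧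
      (∀ᶠ x in 𝓝 p, Φ p < Φ x → x ∈ S₁ ∪ S₂) ∧ (S₁ = S₂ ∨ p ∈ Z)) :
    k ≤ Z.ncard + 1 := by
  classical
  -- each local lobe lies in the component of a pole
  have key : ∀ p, p ∉ range P → ∃ a b : Fin k,
      (∀ᶠ x in 𝓝 p, Φ p < Φ x → x ∈ connectedComponentIn {y | Φ p < Φ y} (P a) ∪
        connectedComponentIn {y | Φ p < Φ y} (P b)) ∧ (a = b ∨ p ∈ Z) := by
    intro p hp
    obtain ⟨S₁, S₂, ⟨x₁, h1⟩, ⟨x₂, h2⟩, hS₁, hS₂, hs₁, hs₂, hev, hor⟩ := hloc p hp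
    have aux : ∀ S : Set X, ∀ x ∈ S, IsPreconnected S → S ⊆ {x | Φ p < Φ x} →
        ∃ a, S ⊆ connectedComponentIn {y | Φ p < Φ y} (P a) := by
      intro S x hx hS hSs
      obtain ⟨a, ha⟩ := topo_pole P Φ hΦ hmax (Φ p) (hcomp _ (hm p)) x (hSs hx)
      refine ⟨a, ?_⟩
      rw [connectedComponentIn_eq ha]
      exact hS.subset_connectedComponentIn hx hSs
    obtain ⟨a, ha⟩ := aux S₁ x₁ h1 hS₁ hs₁
    rcases hor with rfl | hpZ
    · refine ⟨a, a, ?_, Or.inl rfl⟩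
      filter_upwards [hev] with x hx hlt
      rcases hx hlt with h | h
      · exact Or.inl (ha h)
      · exact Or.inl (ha h)
    · obtain ⟨b, hb⟩ := aux S₂ x₂ h2 hS₂ hs₂
      refine ⟨a, b, ?_, Or.inr hpZ⟩
      filter_upwards [hev] with x hx hlt
      rcases hx hlt with h | h
      · exact Or.inl (ha h)
      · exact Or.inr (hb h)
  have : Nonempty (Fin k) := ⟨⟨0, hk⟩⟩
  choose! a b hab hor using key
  set Eset : Set (Sym2 (Fin k)) := (fun p => s(a p, b p)) '' Z with hE
  set G := SimpleGraph.fromEdgeSet Eset with hG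
  have hconnG : G.Connected := by
    rw [SimpleGraph.connected_iff_exists_forall_reachable]
    refine ⟨⟨0, hk⟩, ?_⟩
    by_contra hcon
    push Not at hcon
    obtain ⟨b₀, hb₀⟩ := hcon
    set A : Set (Fin k) := {i | G.Reachable ⟨0, hk⟩ i} with hA
    obtain ⟨p, hp, hdis, hcA, hcB⟩ := topo_cut P hP Φ hΦ htop hmax m hcomp hconn A ⟨0, hk⟩ b₀
      (SimpleGraph.Reachable.refl _) hb₀
    have hmeet : ∀ B : Set (Fin k),
        p ∈ closure (⋃ i ∈ B, connectedComponentIn {y | Φ p < Φ y} (P i)) →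
        ∃ i ∈ B, ∃ x, x ∈ connectedComponentIn {y | Φ p < Φ y} (P i) ∧
          (x ∈ connectedComponentIn {y | Φ p < Φ y} (P (a p)) ∨
            x ∈ connectedComponentIn {y | Φ p < Φ y} (P (b p))) := by
      intro B hB
      obtain ⟨x, hx1, hx2⟩ := ((mem_closure_iff_frequently.1 hB).and_eventually (hab p hp)).exists
      rw [mem_iUnion₂] at hx1
      obtain ⟨i, hi, hxi⟩ := hx1
      exact ⟨i, hi, x, hxi, hx2 (connectedComponentIn_subset {y | Φ p < Φ y} _ hxi)⟩
    have hsame : ∀ i j x, x ∈ connectedComponentIn {y | Φ p < Φ y} (P i) →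
        x ∈ connectedComponentIn {y | Φ p < Φ y} (P j) → (i ∈ A ↔ j ∈ A) := by
      intro i j x hi hj
      by_cases h1 : i ∈ A <;> by_cases h2 : j ∈ A
      · simp [h1, h2]
      · exact absurd hj (Set.disjoint_left.1 (hdis i h1 j h2) hi)
      · exact absurd hi (Set.disjoint_left.1 (hdis j h2 i h1) hj)
      · simp [h1, h2]
    obtain ⟨i, hiA, x, hxi, hx⟩ := hmeet A hcA
    obtain ⟨j, hjA, y, hyj, hy⟩ := hmeet Aᶜ hcB
    have hxor : (a p ∈ A ∧ b p ∉ A) ∨ (b p ∈ A ∧ a p ∉ A) := by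
      have hjA' : j ∉ A := hjA
      rcases hx with hx | hx <;> rcases hy with hy | hy
      · have := hsame _ _ _ hxi hx; have := hsame _ _ _ hyj hy; tauto
      · have := hsame _ _ _ hxi hx; have := hsame _ _ _ hyj hy; tauto
      · have := hsame _ _ _ hxi hx; have := hsame _ _ _ hyj hy; tauto
      · have := hsame _ _ _ hxi hx; have := hsame _ _ _ hyj hy; tauto
    have hne : a p ≠ b p := by
      intro h; rw [h] at hxor; tauto
    have hpZ : p ∈ Z := (hor p hp).resolve_left hne
    have hadj : G.Adj (a p) (b p) := by
      rw [hG, SimpleGraph.fromEdgeSet_adj]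
      exact ⟨⟨p, hpZ, rfl⟩, hne⟩
    rcases hxor with ⟨h1, h2⟩ | ⟨h1, h2⟩
    · exact h2 (SimpleGraph.Reachable.trans h1 hadj.reachable)
    · exact h2 (SimpleGraph.Reachable.trans h1 hadj.symm.reachable)
  have h1 := hconnG.card_vert_le_card_edgeSet_add_one
  have h2 : Nat.card G.edgeSet ≤ Z.ncard := by
    rw [Nat.card_coe_set_eq]
    refine le_trans (Set.ncard_le_ncard ?_ (hZ.image _)) (Set.ncard_image_le hZ (f := fun p => s(a p, b p)))
    rw [hG, SimpleGraph.edgeSet_fromEdgeSet]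
    exact sdiff_subset
  simp only [Nat.card_eq_fintype_card, Fintype.card_fin] at h1
  simp only [Nat.card_eq_fintype_card] at h2
  omega

section localpart
variable {E : Type*} [NormedAddCommGroup E] [InnerProductSpace ℝ E]

theorem line_mem {B : Set E} (hBc : Convex ℝ B) {a v : E} (ha : a ∈ B) (hav : a + v ∈ B)
    {t : ℝ} (ht : t ∈ Icc (0 : ℝ) 1) : a + t • v ∈ B := by
  have := hBc.add_smul_mem ha hav ht
  exact this

theorem line_deriv {F : Type*} [NormedAddCommGroup F] [NormedSpace ℝ F]
    {f : E → F} (a v : E) (t : ℝ) (hf : DifferentiableAt ℝ f (a + t • v)) :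
    HasDerivAt (fun t : ℝ => f (a + t • v)) (fderiv ℝ f (a + t • v) v) t := by
  have h1 : HasDerivAt (fun t : ℝ => a + t • v) v t := by
    simpa using ((hasDerivAt_id t).smul_const v).const_add a
  exact hf.hasFDerivAt.comp_hasDerivAt t h1

theorem line_deriv2 {f : E → ℝ} (a v : E) (t : ℝ)
    (hf : DifferentiableAt ℝ (fderiv ℝ f) (a + t • v)) :
    HasDerivAt (fun t : ℝ => fderiv ℝ f (a + t • v) v)
      (fderiv ℝ (fderiv ℝ f) (a + t • v) v v) t := by
  have h1 := line_deriv a v t hf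
  have h2 := h1.clm_apply (hasDerivAt_const t v)
  simpa using h2

theorem line_increasing {f : E → ℝ} {B : Set E} (hBc : Convex ℝ B)
    (hf : ∀ x ∈ B, DifferentiableAt ℝ f x) {a v : E} (ha : a ∈ B) (hav : a + v ∈ B)
    (hv : ∀ x ∈ B, 0 < fderiv ℝ f x v) : f a < f (a + v) := by
  have hm : StrictMonoOn (fun t : ℝ => f (a + t • v)) (Icc 0 1) := by
    apply strictMonoOn_of_hasDerivWithinAt_pos (convex_Icc 0 1)
      (f' := fun t => fderiv ℝ f (a + t • v) v)
    · intro t ht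
      exact (line_deriv a v t (hf _ (line_mem hBc ha hav ht))).continuousAt.continuousWithinAt
    · intro t ht
      exact (line_deriv a v t
        (hf _ (line_mem hBc ha hav (interior_subset ht)))).hasDerivWithinAt
    · intro t ht
      exact hv _ (line_mem hBc ha hav (interior_subset ht))
  have := hm (by simp) (by simp) (show (0 : ℝ) < 1 by norm_num)
  simpa using this

theorem line_convex {f : E → ℝ} {B : Set E} (hBc : Convex ℝ B)
    (hf : ∀ x ∈ B, DifferentiableAt ℝ f x) (hf2 : ∀ x ∈ B, DifferentiableAt ℝ (fderiv ℝ f) x)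
    {a v : E} (ha : a ∈ B) (hav : a + v ∈ B) (h0 : fderiv ℝ f a v = 0)
    (hv : ∀ x ∈ B, 0 < fderiv ℝ (fderiv ℝ f) x v v) : f a < f (a + v) := by
  have hm : StrictMonoOn (fun t : ℝ => fderiv ℝ f (a + t • v) v) (Icc 0 1) := by
    apply strictMonoOn_of_hasDerivWithinAt_pos (convex_Icc 0 1)
      (f' := fun t => fderiv ℝ (fderiv ℝ f) (a + t • v) v v)
    · intro t ht
      exact (line_deriv2 a v t (hf2 _ (line_mem hBc ha hav ht))).continuousAt.continuousWithinAt
    · intro t ht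
      exact (line_deriv2 a v t
        (hf2 _ (line_mem hBc ha hav (interior_subset ht)))).hasDerivWithinAt
    · intro t ht
      exact hv _ (line_mem hBc ha hav (interior_subset ht))
  have hm : StrictMonoOn (fun t : ℝ => f (a + t • v)) (Icc 0 1) := by
    apply strictMonoOn_of_hasDerivWithinAt_pos (convex_Icc 0 1)
      (f' := fun t => fderiv ℝ f (a + t • v) v)
    · intro t ht
      exact (line_deriv a v t (hf _ (line_mem hBc ha hav ht))).continuousAt.continuousWithinAt
    · intro t ht
      exact (line_deriv a v t
        (hf _ (line_mem hBc ha hav (interior_subset ht)))).hasDerivWithinAt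
    · intro t ht
      rw [interior_Icc] at ht
      have := hm (show (0 : ℝ) ∈ Icc (0 : ℝ) 1 by simp) ⟨ht.1.le, ht.2.le⟩ ht.1
      simpa [h0] using this
  have := hm (by simp) (by simp) (show (0 : ℝ) < 1 by norm_num)
  simpa using this

theorem line_concave {f : E → ℝ} {B : Set E} (hBc : Convex ℝ B)
    (hf : ∀ x ∈ B, DifferentiableAt ℝ f x) (hf2 : ∀ x ∈ B, DifferentiableAt ℝ (fderiv ℝ f) x)
    {a v : E} (ha : a ∈ B) (hav : a + v ∈ B)
    (hv : ∀ x ∈ B, fderiv ℝ (fderiv ℝ f) x v v ≤ 0) (c : ℝ) (h0 : c < f a) (h1 : c < f (a + v))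
    {t : ℝ} (ht : t ∈ Icc (0 : ℝ) 1) : c < f (a + t • v) := by
  have hm : ConcaveOn ℝ (Icc (0 : ℝ) 1) (fun t : ℝ => f (a + t • v)) := by
    apply concaveOn_of_hasDerivWithinAt2_nonpos (convex_Icc 0 1)
      (f' := fun t => fderiv ℝ f (a + t • v) v)
      (f'' := fun t => fderiv ℝ (fderiv ℝ f) (a + t • v) v v)
    · intro t ht
      exact (line_deriv a v t (hf _ (line_mem hBc ha hav ht))).continuousAt.continuousWithinAt
    · intro t ht
      exact (line_deriv a v t
        (hf _ (line_mem hBc ha hav (interior_subset ht)))).hasDerivWithinAt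
    · intro t ht
      exact (line_deriv2 a v t
        (hf2 _ (line_mem hBc ha hav (interior_subset ht)))).hasDerivWithinAt
    · intro t ht
      exact hv _ (line_mem hBc ha hav (interior_subset ht))
  have := hm.2 (show (0 : ℝ) ∈ Icc (0 : ℝ) 1 by simp) (show (1 : ℝ) ∈ Icc (0 : ℝ) 1 by simp)
    (show 0 ≤ 1 - t by linarith [ht.2]) ht.1 (by ring)
  simp only [smul_eq_mul, zero_smul, add_zero, one_smul, mul_zero, zero_add, mul_one] at this
  refine lt_of_lt_of_le ?_ this
  rcases lt_or_eq_of_le ht.1 with h | h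
  · nlinarith [ht.2]
  · subst h; simpa using h0

theorem posdef_nhds [FiniteDimensional ℝ E] {B : E → E →L[ℝ] E →L[ℝ] ℝ} {p : E}
    (hB : ContinuousAt B p)
    (W : Submodule ℝ E) (hW : ∀ u ∈ W, u ≠ 0 → 0 < B p u u) :
    ∀ᶠ x in 𝓝 p, ∀ u ∈ W, u ≠ 0 → 0 < B x u u := by
  have hK : IsCompact (Metric.sphere (0 : E) 1 ∩ W) :=
    (isCompact_sphere 0 1).inter_right W.closed_of_finiteDimensional
  have h := hK.eventually_forall_of_forall_eventually (x₀ := p) (P := fun x u => 0 < B x u u) (by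
    intro u hu
    have hu0 : u ≠ 0 := by
      rintro rfl
      simpa using hu.1
    have hc : ContinuousAt (fun z : E × E => B z.1 z.2 z.2) (p, u) := by
      have h1 : ContinuousAt (fun z : E × E => B z.1) (p, u) :=
        ContinuousAt.comp (f := Prod.fst) (g := B) hB continuousAt_fst
      exact (h1.clm_apply continuousAt_snd).clm_apply continuousAt_snd
    exact hc.eventually (lt_mem_nhds (hW u hu.2 hu0)))
  filter_upwards [h] with x hx u hu hu0
  have hn : 0 < ‖u‖ := norm_pos_iff.2 hu0
  have := hx (‖u‖⁻¹ • u) ⟨by simp [norm_smul, hn.ne'], W.smul_mem _ hu⟩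
  simp only [map_smul, smul_apply, smul_eq_mul] at this
  have hi : 0 < ‖u‖⁻¹ := inv_pos.2 hn
  exact (mul_pos_iff_of_pos_left hi).1 ((mul_pos_iff_of_pos_left hi).1 this)

theorem mem_closure_ray {S : Set E} {p w : E} (h : ∀ t : ℝ, 0 < t → t ≤ 1 → p + t • w ∈ S) :
    p ∈ closure S := by
  have hc : Tendsto (fun t : ℝ => p + t • w) (𝓝[>] 0) (𝓝 p) := by
    have : Continuous (fun t : ℝ => p + t • w) := by fun_prop
    have := this.tendsto 0
    simp only [zero_smul, add_zero] at this
    exact this.mono_left nhdsWithin_le_nhds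
  refine mem_closure_of_tendsto hc ?_
  filter_upwards [Ioc_mem_nhdsGT (show (0 : ℝ) < 1 by norm_num)] with t ht
  exact h t ht.1 ht.2

/-- Near a regular point the strict superlevel set is locally connected. -/
theorem local_regular {f : E → ℝ} {O : Set E} (hO : IsOpen O)
    (hf : ContDiffOn ℝ 2 f O) {p : E} (hp : p ∈ O) (hcrit : fderiv ℝ f p ≠ 0) :
    p ∈ closure {x | x ∈ O ∧ f p < f x} ∧
    ∃ S : Set E, S.Nonempty ∧ IsPreconnected S ∧ S ⊆ {x | x ∈ O ∧ f p < f x} ∧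
      ∀ᶠ x in 𝓝 p, f p < f x → x ∈ S := by
  have hdiff : ∀ x ∈ O, DifferentiableAt ℝ f x := fun x hx =>
    (hf.contDiffAt (hO.mem_nhds hx)).differentiableAt (by norm_num)
  have hcont : ContinuousAt (fderiv ℝ f) p :=
    ((hf.fderiv_of_isOpen hO (m := 1) (by norm_num)).continuousOn.continuousAt (hO.mem_nhds hp))
  obtain ⟨w, hw⟩ : ∃ w, 0 < fderiv ℝ f p w := by
    by_contra h
    push Not at h
    apply hcrit
    ext w
    have h1 := h w
    have h2 := h (-w)
    simp only [map_neg] at h2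
    simp only [zero_apply]
    linarith
  have hev : ∀ᶠ x in 𝓝 p, x ∈ O ∧ 0 < fderiv ℝ f x w :=
    (hO.eventually_mem hp).and ((hcont.clm_apply continuousAt_const).eventually (lt_mem_nhds hw))
  obtain ⟨δ, hδ, hball⟩ := Metric.eventually_nhds_iff_ball.1 hev
  obtain ⟨s, hs, hsw⟩ : ∃ s : ℝ, 0 < s ∧ ‖s • w‖ < δ / 2 := by
    refine ⟨δ / 2 / (‖w‖ + 1), by positivity, ?_⟩
    rw [norm_smul, Real.norm_of_nonneg (by positivity), div_mul_eq_mul_div,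
      div_lt_iff₀ (by positivity)]
    nlinarith [norm_nonneg w]
  set v := s • w with hv
  have hvpos : ∀ x ∈ Metric.ball p δ, 0 < fderiv ℝ f x v := by
    intro x hx
    rw [hv, map_smul, smul_eq_mul]
    exact mul_pos hs (hball x hx).2
  have hinc : ∀ (x : E) (t : ℝ), x ∈ Metric.ball p (δ / 2) → 0 < t → t ≤ 1 →
      x + t • v ∈ O ∧ f x < f (x + t • v) := by
    intro x t hx ht ht1
    have hmem : x + t • v ∈ Metric.ball p δ := by
      rw [mem_ball_iff_norm] at hx ⊢
      have : x + t • v - p = (x - p) + t • v := by abel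
      rw [this]
      have h3 : ‖t • v‖ ≤ ‖v‖ := by
        rw [norm_smul, Real.norm_of_nonneg ht.le]
        nlinarith [norm_nonneg v]
      have := norm_add_le (x - p) (t • v)
      linarith
    have hx' : x ∈ Metric.ball p δ := Metric.ball_subset_ball (by linarith) hx
    refine ⟨(hball _ hmem).1, line_increasing (convex_ball p δ)
      (fun y hy => hdiff y (hball y hy).1) hx' hmem ?_⟩
    intro y hy
    rw [map_smul, smul_eq_mul]
    exact mul_pos ht (hvpos y hy)
  have hpb : p ∈ Metric.ball p (δ / 2) := Metric.mem_ball_self (by linarith)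
  have hpv := hinc p 1 hpb one_pos le_rfl
  rw [one_smul] at hpv
  have hcf : ContinuousAt f (p + v) := (hdiff _ hpv.1).continuousAt
  have hev2 : ∀ᶠ x in 𝓝 (p + v), x ∈ O ∧ f p < f x :=
    (hO.eventually_mem hpv.1).and (hcf.eventually (lt_mem_nhds hpv.2))
  obtain ⟨ε, hε, hεb⟩ := Metric.eventually_nhds_iff_ball.1 hev2
  refine ⟨mem_closure_ray (w := v) fun t ht ht1 => hinc p t hpb ht ht1, ?_⟩
  refine ⟨{y | ∃ x ∈ Metric.ball p (min (δ / 2) ε), f p < f x ∧ y ∈ segment ℝ x (x + v)} ∪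
    Metric.ball (p + v) ε, ⟨p + v, Or.inr (Metric.mem_ball_self hε)⟩, ?_, ?_, ?_⟩
  · apply isPreconnected_of_forall (p + v)
    rintro y (⟨x, hx, hfx, hy⟩ | hy)
    · refine ⟨segment ℝ x (x + v) ∪ Metric.ball (p + v) ε, ?_, Or.inr (Metric.mem_ball_self hε),
        Or.inl hy, ?_⟩
      · rintro z (hz | hz)
        · exact Or.inl ⟨x, hx, hfx, hz⟩
        · exact Or.inr hz
      · refine IsPreconnected.union (x + v) (right_mem_segment ℝ _ _) ?_
          (convex_segment _ _).isPreconnected (convex_ball _ _).isPreconnected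
        have := Metric.ball_subset_ball (min_le_right _ _) hx
        rw [mem_ball_iff_norm] at this ⊢
        simpa using this
    · exact ⟨Metric.ball (p + v) ε, subset_union_right, Metric.mem_ball_self hε, hy,
        (convex_ball _ _).isPreconnected⟩
  · rintro y (⟨x, hx, hfx, hy⟩ | hy)
    · rw [segment_eq_image'] at hy
      obtain ⟨t, ht, rfl⟩ := hy
      have hxb := Metric.ball_subset_ball (min_le_left _ _) hx
      simp only [add_sub_cancel_left]
      rcases lt_or_eq_of_le ht.1 with h | h
      · have := hinc x t hxb h ht.2
        exact ⟨this.1, hfx.trans this.2⟩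
      · rw [← h, zero_smul, add_zero]
        exact ⟨(hball x (Metric.ball_subset_ball (by linarith) hxb)).1, hfx⟩
    · exact hεb y hy
  · filter_upwards [Metric.ball_mem_nhds p (show 0 < min (δ / 2) ε by positivity)] with x hx hfx
    exact Or.inl ⟨x, hx, hfx, left_mem_segment ℝ _ _⟩

/-- Near a nondegenerate critical point the strict superlevel set retracts onto the
positive space of the Hessian. -/
theorem local_retract [FiniteDimensional ℝ E] {f : E → ℝ} {O : Set E} (hO : IsOpen O)
    (hf : ContDiffOn ℝ 2 f O) {p : E} (hp : p ∈ O) (hcrit : fderiv ℝ f p = 0)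
    (W : Submodule ℝ E) (hpos : ∀ u ∈ W, u ≠ 0 → 0 < fderiv ℝ (fderiv ℝ f) p u u)
    (hneg : ∀ u ∈ Wᗮ, u ≠ 0 → fderiv ℝ (fderiv ℝ f) p u u < 0) :
    ∃ r > 0, Metric.ball p r ⊆ O ∧
      (∀ u ∈ W, u ≠ 0 → ‖u‖ < r → f p < f (p + u)) ∧
      (∀ x ∈ Metric.ball p r, f p < f x → W.starProjection (x - p) ≠ 0) ∧
      (∀ D : Set E, D.Nonempty → IsPreconnected D → (∀ u ∈ D, u ∈ W ∧ u ≠ 0 ∧ ‖u‖ < r) →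
        IsPreconnected {x | x ∈ Metric.ball p r ∧ f p < f x ∧ W.starProjection (x - p) ∈ D}) := by
  have hf1 : ContDiffOn ℝ 1 (fderiv ℝ f) O := hf.fderiv_of_isOpen hO (by norm_num)
  have hf2 : ContDiffOn ℝ 0 (fderiv ℝ (fderiv ℝ f)) O := hf1.fderiv_of_isOpen hO (by norm_num)
  have hcont : ContinuousAt (fderiv ℝ (fderiv ℝ f)) p := hf2.continuousOn.continuousAt
    (hO.mem_nhds hp)
  have hev1 := posdef_nhds hcont W hpos
  have hev2 := posdef_nhds (B := fun x => - fderiv ℝ (fderiv ℝ f) x) hcont.neg Wᗮ (by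
    intro u hu hu0
    simpa using hneg u hu hu0)
  obtain ⟨r, hr, hball⟩ := Metric.eventually_nhds_iff_ball.1
    ((hO.eventually_mem hp).and (hev1.and hev2))
  have hd1 : ∀ x ∈ Metric.ball p r, DifferentiableAt ℝ f x := fun x hx =>
    (hf.contDiffAt (hO.mem_nhds (hball x hx).1)).differentiableAt (by norm_num)
  have hd2 : ∀ x ∈ Metric.ball p r, DifferentiableAt ℝ (fderiv ℝ f) x := fun x hx =>
    (hf1.contDiffAt (hO.mem_nhds (hball x hx).1)).differentiableAt (by norm_num)
  have hpb : p ∈ Metric.ball p r := Metric.mem_ball_self hr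
  have hup : ∀ u ∈ W, u ≠ 0 → ‖u‖ < r → f p < f (p + u) := by
    intro u hu hu0 hur
    exact line_convex (convex_ball p r) hd1 hd2 hpb (by simpa using hur) (by simp [hcrit])
      (fun x hx => (hball x hx).2.1 u hu hu0)
  have hconc : ∀ v ∈ Wᗮ, ∀ x ∈ Metric.ball p r, fderiv ℝ (fderiv ℝ f) x v v ≤ 0 := by
    intro v hv x hx
    by_cases hv0 : v = 0
    · simp [hv0]
    · have := (hball x hx).2.2 v hv hv0
      simp only [neg_apply] at this
      linarith
  refine ⟨r, hr, fun x hx => (hball x hx).1, hup, ?_, ?_⟩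
  · intro x hx hfx h0
    rw [Submodule.starProjection_apply_eq_zero_iff] at h0
    have hne : x - p ≠ 0 := by
      intro h
      rw [sub_eq_zero.1 h] at hfx
      exact lt_irrefl _ hfx
    have hfn : fderiv ℝ (fun x => - f x) = fun x => - fderiv ℝ f x := by
      ext1 x; exact fderiv_fun_neg
    have := line_convex (f := fun x => - f x) (convex_ball p r) (fun x hx => (hd1 x hx).neg)
      (by rw [hfn]; exact fun x hx => (hd2 x hx).neg) hpb (v := x - p) (by simpa using hx)
      (by simp [hcrit]) (by
        intro y hy
        rw [hfn, fderiv_fun_neg]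
        exact (hball y hy).2.2 _ h0 hne)
    simp only [add_sub_cancel] at this
    linarith
  · rintro D ⟨d, hd⟩ hD hDW
    have hproj : ∀ u ∈ D, W.starProjection (p + u - p) = u := by
      intro u hu
      rw [add_sub_cancel_left, Submodule.starProjection_eq_self_iff]
      exact (hDW u hu).1
    have hmemD : ∀ u ∈ D, p + u ∈ {x | x ∈ Metric.ball p r ∧ f p < f x ∧
        W.starProjection (x - p) ∈ D} := by
      intro u hu
      obtain ⟨h1, h2, h3⟩ := hDW u hu
      refine ⟨by simpa using h3, hup u h1 h2 h3, ?_⟩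
      rw [hproj u hu]; exact hu
    have hDp : IsPreconnected ((fun u => p + u) '' D) :=
      hD.image _ (by fun_prop)
    apply isPreconnected_of_forall (p + d)
    rintro y ⟨hy, hfy, hyD⟩
    set u := W.starProjection (y - p) with hu
    refine ⟨((fun u => p + u) '' D) ∪ segment ℝ (p + u) y, ?_, Or.inl ⟨d, hd, rfl⟩,
      Or.inr (right_mem_segment ℝ _ _), ?_⟩
    · rintro z (⟨u', hu', rfl⟩ | hz)
      · exact hmemD u' hu'
      · rw [segment_eq_image'] at hz
        obtain ⟨t, ht, rfl⟩ := hz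
        have hv : y - (p + u) ∈ Wᗮ := by
          have := Submodule.sub_starProjection_mem_orthogonal (K := W) (y - p)
          rwa [sub_sub] at this
        have hpu := hmemD u hyD
        have hsum : p + u + (y - (p + u)) = y := by abel
        refine ⟨line_mem (convex_ball p r) hpu.1 (by rw [hsum]; exact hy) ht, ?_, ?_⟩
        · exact line_concave (convex_ball p r) hd1 hd2 hpu.1 (by rw [hsum]; exact hy)
            (hconc _ hv) (f p) hpu.2.1 (by rw [hsum]; exact hfy) ht
        · have h5 : p + u + t • (y - (p + u)) - p = u + t • (y - (p + u)) := by abel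
          have h6 : W.starProjection (y - (p + u)) = 0 :=
            (Submodule.starProjection_apply_eq_zero_iff _).2 hv
          have h7 : W.starProjection u = u :=
            Submodule.starProjection_eq_self_iff.2 (Submodule.starProjection_apply_mem W _)
          rw [h5, map_add, map_smul, h6, h7]
          simpa using hyD
    · exact IsPreconnected.union (p + u) ⟨u, hyD, rfl⟩ (left_mem_segment ℝ _ _) hDp
        (convex_segment _ _).isPreconnected

theorem punctured_preconnected [FiniteDimensional ℝ E] (W : Submodule ℝ E)
    (hW : 1 < Module.finrank ℝ W) (r : ℝ) :
    IsPreconnected {u : E | u ∈ W ∧ u ≠ 0 ∧ ‖u‖ < r} := by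
  have hrank : 1 < Module.rank ℝ W := by
    rw [← Module.finrank_eq_rank]; exact_mod_cast hW
  have h1 := isPreconnected_sphere hrank 0 1
  have h2 := h1.prod (isPreconnected_Ioo (a := (0 : ℝ)) (b := r))
  have h3 := h2.image (fun z : W × ℝ => z.2 • (z.1 : E)) (by fun_prop)
  convert h3 using 1
  ext u
  constructor
  · rintro ⟨hu, hu0, hur⟩
    have hn : 0 < ‖u‖ := norm_pos_iff.2 hu0
    refine ⟨(⟨‖u‖⁻¹ • u, W.smul_mem _ hu⟩, ‖u‖), ⟨?_, hn, hur⟩, ?_⟩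
    · rw [mem_sphere_zero_iff_norm, Submodule.coe_norm, norm_smul, norm_inv, norm_norm,
        inv_mul_cancel₀ hn.ne']
    · simp [smul_smul, hn.ne']
  · rintro ⟨⟨w, t⟩, ⟨hw, ht0, htr⟩, rfl⟩
    have hw1 : ‖(w : E)‖ = 1 := by simpa using hw
    have hw0 : (w : E) ≠ 0 := by
      intro h; rw [h] at hw1; simp at hw1
    have ht0' : 0 < t := ht0
    refine ⟨W.smul_mem _ w.2, smul_ne_zero ht0'.ne' hw0, ?_⟩
    simp only [norm_smul, hw1, mul_one, Real.norm_of_nonneg ht0'.le]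
    exact htr

/-- Local structure at a nondegenerate critical point that is not a local maximum. -/
theorem local_critical [FiniteDimensional ℝ E] {f : E → ℝ} {O : Set E} (hO : IsOpen O)
    (hf : ContDiffOn ℝ 2 f O) {p : E} (hp : p ∈ O) (hcrit : fderiv ℝ f p = 0)
    (W : Submodule ℝ E) (hpos : ∀ u ∈ W, u ≠ 0 → 0 < fderiv ℝ (fderiv ℝ f) p u u)
    (hneg : ∀ u ∈ Wᗮ, u ≠ 0 → fderiv ℝ (fderiv ℝ f) p u u < 0) (hW : W ≠ ⊥) :
    p ∈ closure {x | x ∈ O ∧ f p < f x} ∧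
    ∃ S₁ S₂ : Set E, S₁.Nonempty ∧ S₂.Nonempty ∧ IsPreconnected S₁ ∧ IsPreconnected S₂ ∧
      S₁ ⊆ {x | x ∈ O ∧ f p < f x} ∧ S₂ ⊆ {x | x ∈ O ∧ f p < f x} ∧
      (∀ᶠ x in 𝓝 p, f p < f x → x ∈ S₁ ∪ S₂) ∧ (S₁ = S₂ ∨ Module.finrank ℝ W = 1) := by
  obtain ⟨r, hr, hball, hup, hproj, hcon⟩ := local_retract hO hf hp hcrit W hpos hneg
  obtain ⟨e', he', he0'⟩ := W.exists_mem_ne_zero_of_ne_bot hW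
  obtain ⟨e, he, he0, her⟩ : ∃ e ∈ W, e ≠ 0 ∧ ‖e‖ = r / 2 := by
    have hn : 0 < ‖e'‖ := norm_pos_iff.2 he0'
    refine ⟨(r / 2 * ‖e'‖⁻¹) • e', W.smul_mem _ he', smul_ne_zero (by positivity) he0', ?_⟩
    rw [norm_smul, Real.norm_of_nonneg (by positivity), mul_assoc, inv_mul_cancel₀ hn.ne', mul_one]
  have hbm : ∀ u, ‖u‖ < r → p + u ∈ Metric.ball p r := by
    intro u hu; simpa using hu
  constructor
  · refine mem_closure_ray (w := e) fun t ht ht1 => ?_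
    have hlt : ‖t • e‖ < r := by
      rw [norm_smul, Real.norm_of_nonneg ht.le, her]; nlinarith
    exact ⟨hball (hbm _ hlt), hup _ (W.smul_mem _ he) (smul_ne_zero ht.ne' he0) hlt⟩
  · have hS : ∀ D : Set E, {x | x ∈ Metric.ball p r ∧ f p < f x ∧ W.starProjection (x - p) ∈ D} ⊆
        {x | x ∈ O ∧ f p < f x} := fun D x hx => ⟨hball hx.1, hx.2.1⟩
    have hne : ∀ D : Set E, ∀ u ∈ D, u ∈ W → u ≠ 0 → ‖u‖ < r →
        {x | x ∈ Metric.ball p r ∧ f p < f x ∧ W.starProjection (x - p) ∈ D}.Nonempty := by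
      intro D u hu huW hu0 hur
      refine ⟨p + u, hbm u hur, hup u huW hu0 hur, ?_⟩
      rw [add_sub_cancel_left, Submodule.starProjection_eq_self_iff.2 huW]
      exact hu
    have hprn : ∀ x ∈ Metric.ball p r, ‖W.starProjection (x - p)‖ < r := fun x hx =>
      lt_of_le_of_lt (Submodule.norm_starProjection_apply_le _ _) (mem_ball_iff_norm.1 hx)
    by_cases h1 : Module.finrank ℝ W = 1
    · have hspan : ∀ u ∈ W, ∃ c : ℝ, c • e = u := by
        have h2 := (finrank_eq_one_iff_of_nonzero' (⟨e, he⟩ : W) (by simpa using he0)).1 h1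
        intro u hu
        obtain ⟨c, hc⟩ := h2 ⟨u, hu⟩
        exact ⟨c, congrArg Subtype.val hc⟩
      set D₁ : Set E := (fun t : ℝ => t • e) '' Ioo 0 2 with hD₁
      set D₂ : Set E := (fun t : ℝ => t • e) '' Ioo (-2) 0 with hD₂
      have hD₁W : ∀ u ∈ D₁, u ∈ W ∧ u ≠ 0 ∧ ‖u‖ < r := by
        rintro u ⟨t, ht, rfl⟩
        refine ⟨W.smul_mem _ he, smul_ne_zero ht.1.ne' he0, ?_⟩
        simp only [norm_smul, her, Real.norm_of_nonneg ht.1.le]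
        nlinarith [ht.2]
      have hD₂W : ∀ u ∈ D₂, u ∈ W ∧ u ≠ 0 ∧ ‖u‖ < r := by
        rintro u ⟨t, ht, rfl⟩
        refine ⟨W.smul_mem _ he, smul_ne_zero ht.2.ne he0, ?_⟩
        simp only [norm_smul, her, Real.norm_of_nonpos ht.2.le]
        nlinarith [ht.1]
      have hm₁ : e ∈ D₁ := ⟨1, by norm_num, by simp⟩
      have hm₂ : -e ∈ D₂ := ⟨-1, by norm_num, by simp⟩
      refine ⟨_, _, hne D₁ e hm₁ (hD₁W _ hm₁).1 (hD₁W _ hm₁).2.1 (hD₁W _ hm₁).2.2,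
        hne D₂ _ hm₂ (hD₂W _ hm₂).1 (hD₂W _ hm₂).2.1 (hD₂W _ hm₂).2.2,
        hcon D₁ ⟨_, hm₁⟩ (isPreconnected_Ioo.image _ (by fun_prop)) hD₁W,
        hcon D₂ ⟨_, hm₂⟩ (isPreconnected_Ioo.image _ (by fun_prop)) hD₂W,
        hS _, hS _, ?_, Or.inr h1⟩
      filter_upwards [Metric.ball_mem_nhds p hr] with x hx hfx
      obtain ⟨c, hc⟩ := hspan _ (Submodule.starProjection_apply_mem W (x - p))
      have hn := hprn x hx
      have h0 := hproj x hx hfx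
      rw [← hc] at hn h0
      rw [norm_smul, her, Real.norm_eq_abs] at hn
      have hc2 : |c| < 2 := by
        by_contra h
        push Not at h
        nlinarith
      rw [abs_lt] at hc2
      have hc0 : c ≠ 0 := by
        rintro rfl; simp at h0
      rcases lt_or_gt_of_ne hc0 with h | h
      · exact Or.inr ⟨hx, hfx, c, ⟨hc2.1, h⟩, hc⟩
      · exact Or.inl ⟨hx, hfx, c, ⟨h, hc2.2⟩, hc⟩
    · have h2 : 1 < Module.finrank ℝ W := by
        have : Module.finrank ℝ W ≠ 0 := by
          rw [Ne, Submodule.finrank_eq_zero]; exact hW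
        omega
      have hme : e ∈ {u : E | u ∈ W ∧ u ≠ 0 ∧ ‖u‖ < r} := ⟨he, he0, by rw [her]; linarith⟩
      have hc := hcon {u : E | u ∈ W ∧ u ≠ 0 ∧ ‖u‖ < r} ⟨e, hme⟩
        (punctured_preconnected W h2 r) (fun u hu => hu)
      have hn := hne {u : E | u ∈ W ∧ u ≠ 0 ∧ ‖u‖ < r} e hme hme.1 hme.2.1 hme.2.2
      refine ⟨_, _, hn, hn, hc, hc, hS _, hS _, ?_, Or.inl rfl⟩
      filter_upwards [Metric.ball_mem_nhds p hr] with x hx hfx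
      exact Or.inl ⟨hx, hfx, Submodule.starProjection_apply_mem W _, hproj x hx hfx, hprn x hx⟩

/-- A nondegenerate symmetric form splits orthogonally in a positive and a negative part. -/
theorem exists_splitting [FiniteDimensional ℝ E] (H : E →L[ℝ] E →L[ℝ] ℝ)
    (hsymm : ∀ u v, H u v = H v u) (hnd : ∀ u, (∀ v, H u v = 0) → u = 0) :
    ∃ W : Submodule ℝ E, (∀ u ∈ W, u ≠ 0 → 0 < H u u) ∧ (∀ u ∈ Wᗮ, u ≠ 0 → H u u < 0) := by
  classical
  have : CompleteSpace E := FiniteDimensional.complete ℝ E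
  set T : E →ₗ[ℝ] E :=
    ((InnerProductSpace.toDual ℝ E).symm.toLinearEquiv.toLinearMap) ∘ₗ (H : E →ₗ[ℝ] (E →L[ℝ] ℝ))
    with hT
  have hTi : ∀ u v, inner ℝ (T u) v = H u v := by
    intro u v
    simp [hT]
  have hTs : T.IsSymmetric := by
    intro u v
    rw [hTi, real_inner_comm, hTi, hsymm]
  set b := hTs.eigenvectorBasis rfl with hb
  set l := hTs.eigenvalues rfl with hl
  have hHb : ∀ i v, H (b i) v = l i * inner ℝ (b i) v := by
    intro i v
    rw [← hTi, hb, hTs.apply_eigenvectorBasis, inner_smul_left]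
    simp [hl]
  have hl0 : ∀ i, l i ≠ 0 := by
    intro i h
    have h1 := hnd (b i) (fun v => by rw [hHb, h, zero_mul])
    have h2 := b.norm_eq_one i
    rw [h1] at h2
    simp at h2
  have hexp : ∀ u, H u u = ∑ i, l i * (inner ℝ (b i) u) ^ 2 := by
    intro u
    have h1 : H u u = H (∑ i, inner ℝ (b i) u • b i) u := by rw [b.sum_repr' u]
    rw [h1, map_sum, sum_apply]
    refine Finset.sum_congr rfl fun i _ => ?_
    rw [map_smul, smul_apply, hHb, smul_eq_mul]
    ring
  have hexne : ∀ u, u ≠ 0 → ∃ i, inner ℝ (b i) u ≠ 0 := by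
    intro u hu
    by_contra h
    push Not at h
    apply hu
    rw [← b.sum_repr' u]
    simp [h]
  set W : Submodule ℝ E := Submodule.span ℝ (b '' {i | 0 < l i}) with hW
  refine ⟨W, ?_, ?_⟩
  · intro u hu hu0
    have hz : ∀ i, ¬ 0 < l i → inner ℝ (b i) u = 0 := by
      intro i hi
      have : W ≤ (LinearMap.ker (innerₛₗ ℝ (b i))) := by
        rw [hW, Submodule.span_le]
        rintro _ ⟨j, hj, rfl⟩
        have hij : i ≠ j := by rintro rfl; exact hi hj
        simpa using b.orthonormal.2 hij
      simpa using this hu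
    rw [hexp]
    obtain ⟨i, hi⟩ := hexne u hu0
    refine Finset.sum_pos' (fun j _ => ?_) ⟨i, Finset.mem_univ _, ?_⟩
    · by_cases hj : 0 < l j
      · positivity
      · rw [hz j hj]; simp
    · have : 0 < l i := by
        by_contra h; exact hi (hz i h)
      positivity
  · intro u hu hu0
    have hz : ∀ i, 0 < l i → inner ℝ (b i) u = 0 := by
      intro i hi
      exact Submodule.inner_right_of_mem_orthogonal
        (Submodule.subset_span (mem_image_of_mem b hi)) hu
    rw [hexp, ← neg_pos, ← Finset.sum_neg_distrib]
    obtain ⟨i, hi⟩ := hexne u hu0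
    refine Finset.sum_pos' (fun j _ => ?_) ⟨i, Finset.mem_univ _, ?_⟩
    · by_cases hj : 0 < l j
      · rw [hz j hj]; simp
      · nlinarith [sq_nonneg (inner ℝ (b j) u : ℝ)]
    · have h1 : ¬ 0 < l i := fun h => hi (hz i h)
      have h2 : l i < 0 := lt_of_le_of_ne (not_lt.1 h1) (hl0 i)
      have h3 : 0 < (inner ℝ (b i) u : ℝ) ^ 2 := by positivity
      nlinarith

end localpart

section potential


theorem hasDerivAt_norm_line (x v a : EuclideanSpace ℝ (Fin 3)) (t : ℝ) (h : x + t • v - a ≠ 0) :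
    HasDerivAt (fun t : ℝ => ‖x + t • v - a‖)
      (inner ℝ (x + t • v - a) v / ‖x + t • v - a‖) t := by
  have h1 : HasDerivAt (fun t : ℝ => x + t • v - a) v t := by
    simpa using (((hasDerivAt_id t).smul_const v).const_add x).sub_const a
  have h2 := h1.norm_sq
  have hn : 0 < ‖x + t • v - a‖ := norm_pos_iff.2 h
  have h3 := h2.sqrt (by simpa using h)
  simp only [Real.sqrt_sq (norm_nonneg _)] at h3
  convert h3 using 1
  field_simp

theorem potential_contDiffAt {k : ℕ} (P : Fin k → (EuclideanSpace ℝ (Fin 3))) (m : ℝ) (x : EuclideanSpace ℝ (Fin 3)) (hx : x ∉ range P) :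
    ContDiffAt ℝ 2 (fun x => m + ∑ i, 1 / (2 * ‖x - P i‖)) x := by
  have hne : ∀ i, x - P i ≠ 0 := fun i h => hx ⟨i, (sub_eq_zero.1 h).symm⟩
  refine contDiffAt_const.add (ContDiffAt.sum fun i _ => ?_)
  refine contDiffAt_const.div (contDiffAt_const.mul
    (ContDiffAt.norm ℝ (contDiffAt_id.sub contDiffAt_const) (hne i))) ?_
  simpa using hne i

theorem potential_fderiv {k : ℕ} (P : Fin k → (EuclideanSpace ℝ (Fin 3))) (m : ℝ) (x v : EuclideanSpace ℝ (Fin 3)) (hx : x ∉ range P) :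
    fderiv ℝ (fun x => m + ∑ i, 1 / (2 * ‖x - P i‖)) x v =
      ∑ i, -(1 / 2) * ((‖x - P i‖ ^ 3)⁻¹ * inner ℝ (x - P i) v) := by
  have hne : ∀ i, x - P i ≠ 0 := fun i h => hx ⟨i, (sub_eq_zero.1 h).symm⟩
  have h1 := line_deriv (f := fun x => m + ∑ i, 1 / (2 * ‖x - P i‖)) x v 0
    (by simpa using (potential_contDiffAt P m x hx).differentiableAt (by norm_num))
  have h2 : HasDerivAt (fun t : ℝ => m + ∑ i, 1 / (2 * ‖x + t • v - P i‖))
      (∑ i, -(1 / 2) * ((‖x - P i‖ ^ 3)⁻¹ * inner ℝ (x - P i) v)) 0 := by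
    refine HasDerivAt.const_add m (HasDerivAt.fun_sum fun i _ => ?_)
    have hn : 0 < ‖x - P i‖ := norm_pos_iff.2 (hne i)
    have h3 := hasDerivAt_norm_line x v (P i) 0 (by simpa using hne i)
    have h4 := (h3.const_mul 2).fun_inv (by simpa using hne i)
    simp only [zero_smul, add_zero] at h4
    simp only [one_div]
    refine h4.congr_deriv ?_
    field_simp
    try ring
  have := h1.unique h2
  simpa using this

theorem potential_hessian {k : ℕ} (P : Fin k → (EuclideanSpace ℝ (Fin 3))) (m : ℝ) (x v : EuclideanSpace ℝ (Fin 3)) (hx : x ∉ range P) :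
    fderiv ℝ (fderiv ℝ (fun x => m + ∑ i, 1 / (2 * ‖x - P i‖))) x v v =
      ∑ i, -(1 / 2) * ((‖x - P i‖ ^ 3)⁻¹ * ‖v‖ ^ 2 -
        3 * (‖x - P i‖ ^ 5)⁻¹ * inner ℝ v (x - P i) ^ 2) := by
  have hne : ∀ i, x - P i ≠ 0 := fun i h => hx ⟨i, (sub_eq_zero.1 h).symm⟩
  have hd : DifferentiableAt ℝ (fderiv ℝ (fun x => m + ∑ i, 1 / (2 * ‖x - P i‖))) x :=
    ((potential_contDiffAt P m x hx).fderiv_right (m := 1) (by norm_num)).differentiableAt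
      (by norm_num)
  have h1 := line_deriv2 (f := fun x => m + ∑ i, 1 / (2 * ‖x - P i‖)) x v 0 (by simpa using hd)
  have hO : IsOpen (range P)ᶜ := (finite_range P).isClosed.isOpen_compl
  have hcont : ContinuousAt (fun t : ℝ => x + t • v) 0 := by fun_prop
  have hev : ∀ᶠ t in 𝓝 (0 : ℝ), x + t • v ∈ (range P)ᶜ :=
    hcont.eventually (hO.mem_nhds (by simpa using hx))
  have h2 : HasDerivAt (fun t : ℝ => ∑ i, -(1 / 2) * ((‖x + t • v - P i‖ ^ 3)⁻¹ *
      inner ℝ (x + t • v - P i) v))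
      (∑ i, -(1 / 2) * ((‖x - P i‖ ^ 3)⁻¹ * ‖v‖ ^ 2 -
        3 * (‖x - P i‖ ^ 5)⁻¹ * inner ℝ v (x - P i) ^ 2)) 0 := by
    refine HasDerivAt.fun_sum fun i _ => HasDerivAt.const_mul _ ?_
    have hn : 0 < ‖x - P i‖ := norm_pos_iff.2 (hne i)
    have h3 := hasDerivAt_norm_line x v (P i) 0 (by simpa using hne i)
    have h4 := (h3.fun_pow 3).fun_inv (by simpa using hne i)
    have h5 : HasDerivAt (fun t : ℝ => x + t • v - P i) v 0 := by
      simpa using (((hasDerivAt_id (0 : ℝ)).smul_const v).const_add x).sub_const (P i)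
    have h6 := h4.fun_mul (h5.inner ℝ (hasDerivAt_const (0 : ℝ) v))
    simp only [zero_smul, add_zero, inner_zero_right, zero_add, real_inner_self_eq_norm_sq] at h6
    convert h6 using 1
    rw [real_inner_comm v (x - P i)]
    field_simp
    ring
  have h3 := h2.congr_of_eventuallyEq (f₁ := fun t : ℝ =>
    fderiv ℝ (fun x => m + ∑ i, 1 / (2 * ‖x - P i‖)) (x + t • v) v) (by
      filter_upwards [hev] with t ht
      exact potential_fderiv P m _ v ht)
  have := h1.unique h3
  simpa using this

theorem potential_trace {k : ℕ} (P : Fin k → (EuclideanSpace ℝ (Fin 3))) (m : ℝ) (x : EuclideanSpace ℝ (Fin 3)) (hx : x ∉ range P) :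
    ∑ j, fderiv ℝ (fderiv ℝ (fun x => m + ∑ i, 1 / (2 * ‖x - P i‖))) x
      (EuclideanSpace.basisFun (Fin 3) ℝ j) (EuclideanSpace.basisFun (Fin 3) ℝ j) = 0 := by
  simp only [potential_hessian P m x _ hx]
  rw [Finset.sum_comm]
  refine Finset.sum_eq_zero fun i _ => ?_
  have hne : x - P i ≠ 0 := fun h => hx ⟨i, (sub_eq_zero.1 h).symm⟩
  have hn : 0 < ‖x - P i‖ := norm_pos_iff.2 hne
  rw [← Finset.mul_sum, Finset.sum_sub_distrib, ← Finset.mul_sum, ← Finset.mul_sum,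
    OrthonormalBasis.sum_sq_inner_right]
  simp only [OrthonormalBasis.norm_eq_one]
  simp only [one_pow, Finset.sum_const, Finset.card_univ, Fintype.card_fin, nsmul_eq_mul]
  push_cast
  field_simp
  ring

/-- Critical points are isolated and stay in a compact set, away from the poles. -/
theorem potential_finite_crit {k : ℕ} (hk : 0 < k) (P : Fin k → (EuclideanSpace ℝ (Fin 3))) (m : ℝ)
    (phi : (EuclideanSpace ℝ (Fin 3)) → ℝ)
    (hphi : phi = fun x => m + ∑ i, 1 / (2 * ‖x - P i‖))
    (hnd : ∀ x, x ∉ Set.range P → fderiv ℝ phi x = 0 → IsNondegenerateCrit phi x) :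
    {x | x ∉ range P ∧ fderiv ℝ phi x = 0}.Finite := by
  have : Nonempty (Fin k) := ⟨⟨0, hk⟩⟩
  by_contra hinf
  obtain ⟨R, hR⟩ := (finite_range P).isBounded.subset_closedBall (0 : EuclideanSpace ℝ (Fin 3))
  have hsub : {x | x ∉ range P ∧ fderiv ℝ phi x = 0} ⊆ Metric.closedBall (0 : EuclideanSpace ℝ (Fin 3)) R := by
    rintro x ⟨hx, hx0⟩
    by_contra hxR
    rw [mem_closedBall_zero_iff, not_le] at hxR
    have h1 := potential_fderiv P m x x hx
    rw [← hphi, hx0] at h1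
    have h2 : ∑ i, -(1 / 2) * ((‖x - P i‖ ^ 3)⁻¹ * inner ℝ (x - P i) x) < 0 := by
      refine Finset.sum_neg (fun i _ => ?_) Finset.univ_nonempty
      have hne : x - P i ≠ 0 := fun h => hx ⟨i, (sub_eq_zero.1 h).symm⟩
      have hn : 0 < ‖x - P i‖ := norm_pos_iff.2 hne
      have hPi : ‖P i‖ ≤ R := by simpa using hR ⟨i, rfl⟩
      have h3 : 0 < inner ℝ (x - P i) x := by
        rw [inner_sub_left, real_inner_self_eq_norm_sq]
        have := real_inner_le_norm (P i) x
        nlinarith [norm_nonneg (P i), norm_nonneg x]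
      have : 0 < (‖x - P i‖ ^ 3)⁻¹ * inner ℝ (x - P i) x := by positivity
      linarith
    rw [← h1] at h2
    simp at h2
  obtain ⟨p, -, hacc⟩ := Set.Infinite.exists_accPt_of_subset_isCompact hinf
    (isCompact_closedBall _ _) hsub
  rw [accPt_iff_frequently_nhdsNE] at hacc
  apply hacc
  by_cases hp : p ∈ range P
  · obtain ⟨j, rfl⟩ := hp
    have ht : Tendsto (fun x => ∑ i, ‖x - P j‖ *
        (-(1 / 2) * ((‖x - P i‖ ^ 3)⁻¹ * inner ℝ (x - P i) (x - P j)))) (𝓝[≠] (P j))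
        (𝓝 (∑ i, if P i = P j then -(1 / 2) else (0 : ℝ))) := by
      refine tendsto_finsetSum _ fun i _ => ?_
      by_cases hij : P i = P j
      · simp only [hij, if_true]
        refine (tendsto_const_nhds (x := -(1 / 2 : ℝ))).congr' ?_
        filter_upwards [self_mem_nhdsWithin] with x hx
        have hne : x - P j ≠ 0 := sub_ne_zero.2 hx
        have hn : 0 < ‖x - P j‖ := norm_pos_iff.2 hne
        rw [real_inner_self_eq_norm_sq]
        field_simp
      · simp only [hij, if_false]
        have hne : P j - P i ≠ 0 := sub_ne_zero.2 (Ne.symm hij)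
        have hc : ContinuousAt (fun x => ‖x - P j‖ *
          (-(1 / 2) * ((‖x - P i‖ ^ 3)⁻¹ * inner ℝ (x - P i) (x - P j)))) (P j) := by
          have h0 : ContinuousAt (fun x => (‖x - P i‖ ^ 3)⁻¹) (P j) :=
            ContinuousAt.inv₀ (by fun_prop) (by simpa using hne)
          have h1 : ContinuousAt (fun x => (inner ℝ (x - P i) (x - P j) : ℝ)) (P j) := by fun_prop
          have h2 : ContinuousAt (fun x => ‖x - P j‖) (P j) := by fun_prop
          exact h2.mul (continuousAt_const.mul (h0.mul h1))
        have := hc.tendsto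
        simp only [sub_self, norm_zero, zero_mul] at this
        exact this.mono_left nhdsWithin_le_nhds
    have hneg : (∑ i, if P i = P j then -(1 / 2) else (0 : ℝ)) < 0 := by
      refine Finset.sum_neg' (fun i _ => ?_) ⟨j, Finset.mem_univ _, by norm_num⟩
      split_ifs <;> norm_num
    filter_upwards [ht.eventually (gt_mem_nhds hneg)] with x hx hxZ
    have h1 := potential_fderiv P m x (x - P j) hxZ.1
    rw [← hphi, hxZ.2] at h1
    rw [← Finset.mul_sum, ← h1] at hx
    simp at hx
  · have hcd : ContDiffAt ℝ 2 phi p := by rw [hphi]; exact potential_contDiffAt P m p hp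
    have hcd1 : ContDiffAt ℝ 1 (fderiv ℝ phi) p := hcd.fderiv_right (by norm_num)
    by_cases hcrit : fderiv ℝ phi p = 0
    · have hdd := (hcd1.differentiableAt (by norm_num)).hasFDerivAt
      have hker : LinearMap.ker (fderiv ℝ (fderiv ℝ phi) p : (EuclideanSpace ℝ (Fin 3)) →ₗ[ℝ] ((EuclideanSpace ℝ (Fin 3)) →L[ℝ] ℝ)) = ⊥ := by
        rw [LinearMap.ker_eq_bot']
        intro u hu
        apply hnd p hp hcrit u
        intro v
        rw [hessianForm, iteratedFDeriv_two_apply]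
        have : fderiv ℝ (fderiv ℝ phi) p u = 0 := hu
        simp [this]
      obtain ⟨K, -, hK⟩ := LinearMap.exists_antilipschitzWith _ hker
      filter_upwards [hdd.eventually_ne (c := 0) ⟨K, hK⟩] with x hx hxZ
      exact hx hxZ.2
    · have := hcd1.continuousAt.eventually_ne hcrit
      filter_upwards [this.filter_mono nhdsWithin_le_nhds] with x hx hxZ
      exact hx hxZ.2

/-- Local structure of the superlevel sets of the potential. -/
theorem potential_local {k : ℕ} (P : Fin k → (EuclideanSpace ℝ (Fin 3))) (m : ℝ)
    (phi : (EuclideanSpace ℝ (Fin 3)) → ℝ)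
    (hphi : phi = fun x => m + ∑ i, 1 / (2 * ‖x - P i‖))
    (hnd : ∀ x, x ∉ Set.range P → fderiv ℝ phi x = 0 → IsNondegenerateCrit phi x)
    (p : EuclideanSpace ℝ (Fin 3)) (hp : p ∉ range P) :
    p ∈ closure {x | x ∈ (range P)ᶜ ∧ phi p < phi x} ∧
    ∃ S₁ S₂ : Set (EuclideanSpace ℝ (Fin 3)), S₁.Nonempty ∧ S₂.Nonempty ∧ IsPreconnected S₁ ∧ IsPreconnected S₂ ∧
      S₁ ⊆ {x | x ∈ (range P)ᶜ ∧ phi p < phi x} ∧ S₂ ⊆ {x | x ∈ (range P)ᶜ ∧ phi p < phi x} ∧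
      (∀ᶠ x in 𝓝 p, phi p < phi x → x ∈ S₁ ∪ S₂) ∧
      (S₁ = S₂ ∨ (p ∉ range P ∧ fderiv ℝ phi p = 0 ∧ HasMorseIndex phi p 2)) := by
  have hO : IsOpen (range P)ᶜ := (finite_range P).isClosed.isOpen_compl
  have hcd : ∀ x ∈ (range P)ᶜ, ContDiffAt ℝ 2 phi x := by
    intro x hx; rw [hphi]; exact potential_contDiffAt P m x hx
  have hf : ContDiffOn ℝ 2 phi (range P)ᶜ := fun x hx => (hcd x hx).contDiffWithinAt
  by_cases hcrit : fderiv ℝ phi p = 0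
  · have hsymm := (hcd p hp).isSymmSndFDerivAt
      (by rw [minSmoothness_of_isRCLikeNormedField])
    have hh : ∀ u v, hessianForm phi p u v = fderiv ℝ (fderiv ℝ phi) p u v := by
      intro u v
      rw [hessianForm, iteratedFDeriv_two_apply]
      simp
    obtain ⟨W, hpos, hneg⟩ := exists_splitting (fderiv ℝ (fderiv ℝ phi) p) hsymm (by
      intro u hu
      exact hnd p hp hcrit u (fun v => by rw [hh, hu v]))
    have hW : W ≠ ⊥ := by
      rintro rfl
      have h1 := potential_trace P m p hp
      rw [← hphi] at h1
      have h2 : ∑ j, fderiv ℝ (fderiv ℝ phi) p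
          (EuclideanSpace.basisFun (Fin 3) ℝ j) (EuclideanSpace.basisFun (Fin 3) ℝ j) < 0 := by
        refine Finset.sum_neg (fun j _ => hneg _ ?_ ?_) Finset.univ_nonempty
        · rw [Submodule.bot_orthogonal_eq_top]; trivial
        · exact (EuclideanSpace.basisFun (Fin 3) ℝ).orthonormal.ne_zero j
      linarith
    obtain ⟨h1, S₁, S₂, a1, a2, a3, a4, a5, a6, a7, a8⟩ :=
      local_critical hO hf hp hcrit W hpos hneg hW
    refine ⟨h1, S₁, S₂, a1, a2, a3, a4, a5, a6, a7, ?_⟩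
    rcases a8 with h | h
    · exact Or.inl h
    · refine Or.inr ⟨hp, hcrit, ⟨Wᗮ, ?_, ?_⟩, ⟨W, ?_, ?_⟩⟩
      · have h2 := W.finrank_add_finrank_orthogonal
        rw [h, finrank_euclideanSpace_fin] at h2
        omega
      · intro u hu hu0
        rw [hh]; exact hneg u hu hu0
      · rw [h]
      · intro u hu hu0
        rw [hh]; exact hpos u hu hu0
  · obtain ⟨h1, S, a1, a2, a3, a4⟩ := local_regular hO hf hp hcrit
    refine ⟨h1, S, S, a1, a1, a2, a2, a3, a3, ?_, Or.inl rfl⟩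
    filter_upwards [a4] with x hx h
    exact Or.inl (hx h)

end potential

/-- If all critical points of the potential of `k ≥ 2` unit point charges are
nondegenerate, then there are at least `k − 1` critical points of Morse
index 2. -/
theorem exists_index_two_critical_points
    {k : ℕ} (hk : 2 ≤ k)
    (P : Fin k → EuclideanSpace ℝ (Fin 3)) (hP : Function.Injective P)
    (m : ℝ) (hm : 0 ≤ m)
    (phi : EuclideanSpace ℝ (Fin 3) → ℝ)
    (hphi : phi = fun x => m + ∑ i, 1 / (2 * ‖x - P i‖))
    (hnd : ∀ x, x ∉ Set.range P → fderiv ℝ phi x = 0 → IsNondegenerateCrit phi x) :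
    k - 1 ≤
      {x | x ∉ Set.range P ∧ fderiv ℝ phi x = 0 ∧ HasMorseIndex phi x 2}.ncard := by
  have hk0 : 0 < k := by omega
  set Z := {x | x ∉ Set.range P ∧ fderiv ℝ phi x = 0 ∧ HasMorseIndex phi x 2} with hZ
  have hZfin : Z.Finite := (potential_finite_crit hk0 P m phi hphi hnd).subset
    fun x hx => ⟨hx.1, hx.2.1⟩
  set Φ : EuclideanSpace ℝ (Fin 3) → ℝ≥0∞ :=
    fun x => ENNReal.ofReal m + ∑ i, (2 * ENNReal.ofReal ‖x - P i‖)⁻¹ with hΦdef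
  have hΦ : Continuous Φ := by
    have h : ∀ i, Continuous fun x : EuclideanSpace ℝ (Fin 3) =>
        (2 * ENNReal.ofReal ‖x - P i‖)⁻¹ := fun i => by
      refine continuous_inv.comp (ENNReal.continuous_const_mul (by norm_num) |>.comp ?_)
      exact ENNReal.continuous_ofReal.comp (by fun_prop)
    exact continuous_const.add (continuous_finsetSum _ fun i _ => h i)
  have hterm : ∀ i x, x ≠ P i →
      (2 * ENNReal.ofReal ‖x - P i‖)⁻¹ = ENNReal.ofReal (1 / (2 * ‖x - P i‖)) := by
    intro i x hx
    have hn : 0 < ‖x - P i‖ := norm_pos_iff.2 (sub_ne_zero.2 hx)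
    rw [one_div, ENNReal.ofReal_inv_of_pos (by positivity), ENNReal.ofReal_mul (by norm_num)]
    simp
  have hΦphi : ∀ x, x ∉ range P → Φ x = ENNReal.ofReal (phi x) := by
    intro x hx
    have hpos : ∀ i ∈ Finset.univ, 0 ≤ 1 / (2 * ‖x - P i‖) := fun i _ => by positivity
    rw [hphi, ENNReal.ofReal_add hm (Finset.sum_nonneg hpos), ENNReal.ofReal_sum_of_nonneg hpos]
    simp only [hΦdef]
    congr 1
    refine Finset.sum_congr rfl fun i _ => hterm i x ?_
    rintro rfl
    exact hx ⟨i, rfl⟩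
  have htop : ∀ i, Φ (P i) = ⊤ := by
    intro i
    simp only [hΦdef, ENNReal.add_eq_top, ENNReal.sum_eq_top]
    right
    exact ⟨i, Finset.mem_univ _, by simp⟩
  have hmlt : ∀ x, ENNReal.ofReal m < Φ x := by
    intro x
    refine ENNReal.lt_add_right ENNReal.ofReal_ne_top ?_
    intro h
    rw [Finset.sum_eq_zero_iff] at h
    have := h ⟨0, hk0⟩ (Finset.mem_univ _)
    rw [ENNReal.inv_eq_zero] at this
    exact ENNReal.mul_ne_top (by norm_num) ENNReal.ofReal_ne_top this
  have hlim : Tendsto Φ (cocompact _) (𝓝 (ENNReal.ofReal m)) := by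
    have h0 : Tendsto Φ (cocompact _) (𝓝 (ENNReal.ofReal m + ∑ i : Fin k, 0)) := by
      refine tendsto_const_nhds.add (tendsto_finsetSum _ fun i _ => ?_)
      have h1 : Tendsto (fun x => ‖x - P i‖) (cocompact _) atTop := by
        simpa only [dist_eq_norm] using tendsto_dist_right_cocompact_atTop (P i)
      have h2 := ENNReal.Tendsto.const_mul (a := 2) (ENNReal.tendsto_ofReal_atTop.comp h1)
        (Or.inl (by simp))
      have h3 := h2.inv
      simpa using h3
    simpa using h0
  have hcomp : ∀ c, ENNReal.ofReal m < c → IsCompact {x | c ≤ Φ x} := by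
    intro c hc
    have h1 := hlim.eventually (gt_mem_nhds hc)
    obtain ⟨K, hK, hKc⟩ := mem_cocompact.1 h1
    refine hK.of_isClosed_subset (isClosed_le continuous_const hΦ) ?_
    intro x hx
    by_contra hxK
    exact not_lt.2 (show c ≤ Φ x from hx) (hKc hxK)
  have hconn : ∃ c, ENNReal.ofReal m < c ∧ ∃ S, IsPreconnected S ∧ S ⊆ {x | c < Φ x} ∧
      range P ⊆ S := by
    obtain ⟨R, hR⟩ := (finite_range P).isBounded.subset_closedBall
      (0 : EuclideanSpace ℝ (Fin 3))
    obtain ⟨y, -, hy⟩ := (isCompact_closedBall (0 : EuclideanSpace ℝ (Fin 3)) R).exists_isMinOn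
      ⟨P ⟨0, hk0⟩, hR ⟨_, rfl⟩⟩ hΦ.continuousOn
    obtain ⟨c, hc1, hc2⟩ := exists_between (hmlt y)
    exact ⟨c, hc1, _, (convex_closedBall _ _).isPreconnected,
      fun x hx => lt_of_lt_of_le (c := Φ x) hc2 (hy hx), hR⟩
  have hphipos : ∀ p, p ∉ range P → 0 ≤ phi p := by
    intro p hp
    rw [hphi]
    positivity
  have hlt : ∀ p, p ∉ range P → ∀ x, x ∉ range P → (Φ p < Φ x ↔ phi p < phi x) := by
    intro p hp x hx
    rw [hΦphi p hp, hΦphi x hx, ENNReal.ofReal_lt_ofReal_iff_of_nonneg (hphipos p hp)]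
  have hO : IsOpen (range P)ᶜ := (finite_range P).isClosed.isOpen_compl
  have hmain := topo_main hk0 P hP Φ hΦ htop (by
      intro p hp
      refine closure_mono ?_ (potential_local P m phi hphi hnd p hp).1
      intro x hx
      exact (hlt p hp x hx.1).2 hx.2) (ENNReal.ofReal m) hmlt hcomp hconn Z hZfin (by
      intro p hp
      obtain ⟨-, S₁, S₂, a1, a2, a3, a4, a5, a6, a7, a8⟩ :=
        potential_local P m phi hphi hnd p hp
      refine ⟨S₁, S₂, a1, a2, a3, a4, fun x hx => (hlt p hp x (a5 hx).1).2 (a5 hx).2,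
        fun x hx => (hlt p hp x (a6 hx).1).2 (a6 hx).2, ?_, a8⟩
      filter_upwards [a7, hO.mem_nhds hp] with x hx hxP hxlt
      exact hx ((hlt p hp x hxP).1 hxlt))
  omega
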